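/- arXiv:2203.07966 — 2 statements merged into one kernel-verified Lean document; each statement's English description precedes it below -/
import Mathlib

section
/- Let v ∈ ℝ^N and let μ ∈ ℝ satisfy μ ≥ max_{1 ≤ i ≤ N} v_i². Then the symmetric N×N matrix M = v vᵀ − diag(v ∘ v) + μ I_N is positive semidefinite, i.e., for all x ∈ ℝ^N, xᵀ M x = (v · x)² − Σ_{i=1}^N v_i² x_i² + μ ‖x‖₂² ≥ 0. -/
open Matrix

/-- The quadratic form of `v vᵀ − diag(v ∘ v) + μ I`, in coordinates. -/
theorem dotProduct_rank_one_sub_diagonal_mulVec {n R : Type*} [Fintype n] [DecidableEq n]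
    [CommRing R] (v x : n → R) (μ : R) :
    x ⬝ᵥ (Matrix.vecMulVec v v - Matrix.diagonal (fun i => v i * v i) +
        μ • (1 : Matrix n n R)).mulVec x =
      (v ⬝ᵥ x) ^ 2 - (∑ i, (v i) ^ 2 * (x i) ^ 2) + μ * ∑ i, (x i) ^ 2 := by
  have h_diag : x ⬝ᵥ (Matrix.diagonal (fun i => v i * v i)).mulVec x =
      ∑ i, (v i) ^ 2 * (x i) ^ 2 :=
    Finset.sum_congr rfl fun i _ => by rw [mulVec_diagonal]; ring
  have h_self : x ⬝ᵥ x = ∑ i, (x i) ^ 2 := Finset.sum_congr rfl fun i _ => (sq (x i)).symm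
  rw [add_mulVec, sub_mulVec, dotProduct_add, dotProduct_sub, h_diag, smul_mulVec, one_mulVec,
    dotProduct_smul, h_self, vecMulVec_mulVec, op_smul_eq_smul, dotProduct_smul,
    dotProduct_comm x v, smul_eq_mul, smul_eq_mul, ← sq]

/-- If `μ ≥ max_i v_i²` then `M = v vᵀ − diag(v ∘ v) + μ I_N` is positive
semidefinite; explicitly, `xᵀ M x = (v·x)² − ∑ i v_i² x_i² + μ ‖x‖² ≥ 0` for all `x`. -/
theorem rank_one_minus_diag_psd (N : ℕ) (v : Fin N → ℝ) (μ : ℝ)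
    (hμ : (⨆ i, (v i) ^ 2) ≤ μ) :
    (Matrix.vecMulVec v v - Matrix.diagonal (fun i => v i * v i) +
        μ • (1 : Matrix (Fin N) (Fin N) ℝ)).PosSemidef ∧
    ∀ x : Fin N → ℝ,
      x ⬝ᵥ (Matrix.vecMulVec v v - Matrix.diagonal (fun i => v i * v i) +
          μ • (1 : Matrix (Fin N) (Fin N) ℝ)).mulVec x =
        (v ⬝ᵥ x) ^ 2 - (∑ i, (v i) ^ 2 * (x i) ^ 2) + μ * ∑ i, (x i) ^ 2 := by
  refine ⟨.of_dotProduct_mulVec_nonneg ?_ fun x => ?_,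
    fun x => dotProduct_rank_one_sub_diagonal_mulVec v x μ⟩
  · simp [IsHermitian, conjTranspose_eq_transpose_of_trivial, transpose_vecMulVec]
  · rw [star_trivial, dotProduct_rank_one_sub_diagonal_mulVec]
    have h_le : ∑ i, (v i) ^ 2 * (x i) ^ 2 ≤ μ * ∑ i, (x i) ^ 2 := by
      rw [Finset.mul_sum]
      exact Finset.sum_le_sum fun i _ => mul_le_mul_of_nonneg_right
        ((le_ciSup (f := fun i => (v i) ^ 2) (Set.finite_range _).bddAbove i).trans hμ)
        (sq_nonneg _)
    linarith [sq_nonneg (v ⬝ᵥ x)]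
end

section
/- (Corollary 1, corrected constant) Fix c ∈ ℝ^N, real scalars x_1,…,x_T, vectors b_1,…,b_T ∈ ℝ^N, and w_h ≥ 0. Suppose w ∈ ℝ^N satisfies |w_i| ≤ w_h for all i, and the regularization weight satisfies μ_p ≥ w_h² · max_{1 ≤ i ≤ N} c_i². Then the function C_p : ℝ^N → ℝ given by C_p(p) = Σ_{t=1}^T ((w∘p) · c − x_t)² + T · Σ_{i=1}^N c_i² w_i² p_i (1−p_i) + μ_p Σ_{t=1}^T ‖p − b_t‖₂² is convex on ℝ^N. -/
/-- A real quadratic polynomial with nonnegative leading coefficient is convex. -/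
theorem convexOn_quadratic {a : ℝ} (ha : 0 ≤ a) (b c : ℝ) :
    ConvexOn ℝ Set.univ (fun s : ℝ => a * s ^ 2 + b * s + c) := by
  refine ⟨convex_univ, fun s _ r _ u v hu hv huv => ?_⟩
  obtain rfl : v = 1 - u := by linarith
  have h : 0 ≤ a * (u * (1 - u) * (s - r) ^ 2) := by positivity
  simp only [smul_eq_mul]
  linear_combination h

/-- A finite sum of convex functions is convex. -/
theorem convexOn_finset_sum {ι E : Type*} [AddCommGroup E] [Module ℝ E] {S : Set E}
    (hS : Convex ℝ S) (A : Finset ι) {f : ι → E → ℝ} (hf : ∀ i ∈ A, ConvexOn ℝ S (f i)) :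
    ConvexOn ℝ S (fun p => ∑ i ∈ A, f i p) := by
  refine ⟨hS, fun p hp q hq u v hu hv huv => ?_⟩
  simp only [Finset.smul_sum, ← Finset.sum_add_distrib]
  exact Finset.sum_le_sum fun i hi => (hf i hi).2 hp hq hu hv huv

/-- Corollary 1, corrected constant: If `|w_i| ≤ w_h` for all `i` and
`μ_p ≥ w_h² · max_i c_i²`, then the training cost
`C_p(p) = ∑_t ((w∘p)·c − x_t)² + T ∑_i c_i² w_i² p_i (1−p_i) + μ_p ∑_t ‖p − b_t‖²`
is convex in `p` on all of `ℝ^N`. -/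
theorem marginal_convexity_in_p (N T : ℕ) (c : Fin N → ℝ) (x : Fin T → ℝ)
    (b : Fin T → Fin N → ℝ) (wh : ℝ) (hwh : 0 ≤ wh) (w : Fin N → ℝ)
    (hw : ∀ i, |w i| ≤ wh) (μp : ℝ) (hμp : wh ^ 2 * (⨆ i, (c i) ^ 2) ≤ μp) :
    ConvexOn ℝ Set.univ
      (fun p : Fin N → ℝ =>
        (∑ t : Fin T, ((∑ i, w i * p i * c i) - x t) ^ 2) +
          (T : ℝ) * (∑ i, (c i) ^ 2 * (w i) ^ 2 * p i * (1 - p i)) +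
          μp * ∑ t : Fin T, ∑ i, (p i - b t i) ^ 2) := by
  have hcw : ∀ i, c i ^ 2 * w i ^ 2 ≤ μp := fun i => by
    have hc : c i ^ 2 ≤ ⨆ j, c j ^ 2 := le_ciSup (Set.finite_range fun j => c j ^ 2).bddAbove i
    calc c i ^ 2 * w i ^ 2 = w i ^ 2 * c i ^ 2 := mul_comm _ _
      _ ≤ wh ^ 2 * ⨆ j, c j ^ 2 :=
        mul_le_mul (sq_le_sq.mpr ((hw i).trans (le_abs_self wh))) hc (sq_nonneg _) (sq_nonneg _)
      _ ≤ μp := hμp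
  have hfit : ∀ t, ConvexOn ℝ Set.univ
      (fun p : Fin N → ℝ => ((∑ i, w i * p i * c i) - x t) ^ 2) := fun t => by
    refine ((convexOn_quadratic zero_le_one (-2 * x t) (x t ^ 2)).comp_linearMap
      (∑ i, (w i * c i) • (LinearMap.proj i : (Fin N → ℝ) →ₗ[ℝ] ℝ))).congr
      fun p _ => ?_
    have hsum : ∑ i, w i * p i * c i = ∑ i, w i * c i * p i :=
      Finset.sum_congr rfl fun i _ => by ring
    simp only [Function.comp_apply, LinearMap.sum_apply, LinearMap.smul_apply,
      LinearMap.proj_apply, smul_eq_mul, hsum]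
    ring
  have hreg : ∀ t i, ConvexOn ℝ Set.univ (fun p : Fin N → ℝ =>
      c i ^ 2 * w i ^ 2 * p i * (1 - p i) + μp * (p i - b t i) ^ 2) := fun t i => by
    refine ((convexOn_quadratic (sub_nonneg.mpr (hcw i))
      (c i ^ 2 * w i ^ 2 - 2 * μp * b t i) (μp * b t i ^ 2)).comp_linearMap
      (LinearMap.proj i : (Fin N → ℝ) →ₗ[ℝ] ℝ)).congr fun p _ => ?_
    simp only [Function.comp_apply, LinearMap.proj_apply]
    ring
  refine (convexOn_finset_sum convex_univ Finset.univ fun t _ =>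
    (hfit t).add (convexOn_finset_sum convex_univ Finset.univ fun i _ => hreg t i)).congr fun p _ => ?_
  simp only [Pi.add_apply, Finset.sum_add_distrib, Finset.sum_const, Finset.card_univ,
    Fintype.card_fin, nsmul_eq_mul, Finset.mul_sum]
  ring
end
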